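/- Let X and Y be second countable, locally compact Hausdorff spaces, H_X an X-module, H_Y a Y-module, and f : X → Y a continuous map. A family of isometries (V_t : H_X → H_Y)_{t∈[1,∞)} is a continuous cover of f if and only if it is a continuous cover of the identity map on Y when H_X is regarded as the Y-module (H_X)_Y via f* : C₀(Y) → C_b(X). -/

import Mathlib

open scoped ZeroAtInfty
open Filter Topology MeasureTheory

noncomputable section

namespace Stmt

variable {X Y : Type*} [TopologicalSpace X] [TopologicalSpace Y]
variable {H₁ H₂ : Type*}
  [NormedAddCommGroup H₁] [InnerProductSpace ℂ H₁] [CompleteSpace H₁]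
  [NormedAddCommGroup H₂] [InnerProductSpace ℂ H₂] [CompleteSpace H₂]

/-- `π` is a nondegenerate ⋆-representation of `C₀(X, ℂ)` on the Hilbert space `H`,
i.e. `H` is an `X`-module. -/
structure IsStarRep {X H : Type*} [TopologicalSpace X] [NormedAddCommGroup H]
    [InnerProductSpace ℂ H] [CompleteSpace H] (π : C₀(X, ℂ) → H →L[ℂ] H) : Prop where
  map_add : ∀ φ ψ, π (φ + ψ) = π φ + π ψ
  map_smul : ∀ (a : ℂ) (φ), π (a • φ) = a • π φ
  map_mul : ∀ φ ψ, π (φ * ψ) = (π φ).comp (π ψ)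
  map_star : ∀ φ, ContinuousLinearMap.adjoint (π φ) = π (star φ)
  nondeg : Dense (↑(Submodule.span ℂ (Set.range fun p : C₀(X, ℂ) × H => π p.1 p.2)) : Set H)

/-- The support of an operator `T` from an `X`-module to a `Y`-module: the set of pairs
`(y, x) ∈ Y × X` near which `T` does not vanish. -/
def opSupport (πX : C₀(X, ℂ) → H₁ →L[ℂ] H₁) (πY : C₀(Y, ℂ) → H₂ →L[ℂ] H₂)
    (T : H₁ →L[ℂ] H₂) : Set (Y × X) :=
  {p | ∀ U : Set X, ∀ V : Set Y, IsOpen U → IsOpen V → p.2 ∈ U → p.1 ∈ V →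
      ∃ (φ : C₀(X, ℂ)) (ψ : C₀(Y, ℂ)), tsupport ⇑φ ⊆ U ∧ tsupport ⇑ψ ⊆ V ∧
        (πY ψ).comp (T.comp (πX φ)) ≠ 0}

/-- A family of isometries `(V_t : H₁ → H₂)_{t ∈ [1,∞)}` is a continuous cover of a
continuous map `f : X → Y` between the underlying spaces of the modules: it is uniformly
norm-continuous and, for every open neighbourhood `U` of the diagonal in `Y⁺ × Y⁺`, one
eventually has `supp (V_t) ⊆ {(y, x) : (y, f x) ∈ U}`. -/
def IsContCover (πX : C₀(X, ℂ) → H₁ →L[ℂ] H₁) (πY : C₀(Y, ℂ) → H₂ →L[ℂ] H₂)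
    (f : X → Y) (V : ℝ → H₁ →L[ℂ] H₂) : Prop :=
  (∀ t : ℝ, 1 ≤ t → ∀ v : H₁, ‖V t v‖ = ‖v‖) ∧
  UniformContinuousOn V (Set.Ici 1) ∧
  ∀ U : Set (OnePoint Y × OnePoint Y), IsOpen U → (∀ z, (z, z) ∈ U) →
    ∃ tU : ℝ, 1 ≤ tU ∧ ∀ t ≥ tU,
      opSupport πX πY (V t) ⊆
        {p : Y × X | ((p.1 : OnePoint Y), ((f p.2 : Y) : OnePoint Y)) ∈ U}

/-- For a continuous `f : X → Y`, `ψ ∈ C₀(Y)` and `φ ∈ C₀(X)`, the function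
`x ↦ ψ(f x) · φ(x)`, an element of `C₀(X)`.  (This is `((ψ ∘ f) · φ)`, the product of the
multiplier `ψ ∘ f ∈ C_b(X)` with `φ`.) -/
def mulCompC0 (f : C(X, Y)) (ψ : C₀(Y, ℂ)) (φ : C₀(X, ℂ)) : C₀(X, ℂ) where
  toFun x := ψ (f x) * φ x
  continuous_toFun := (ψ.continuous.comp f.continuous).mul φ.continuous
  zero_at_infty' := by
    have h : Tendsto (fun x : X => ‖ψ‖ * ‖φ x‖) (cocompact X) (𝓝 (‖ψ‖ * ‖(0 : ℂ)‖)) :=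
      tendsto_const_nhds.mul (φ.zero_at_infty'.norm)
    refine squeeze_zero_norm (fun x => ?_) (by simpa using h)
    calc ‖ψ (f x) * φ x‖ = ‖ψ (f x)‖ * ‖φ x‖ := norm_mul _ _
      _ ≤ ‖ψ‖ * ‖φ x‖ := by
          have h1 : ‖ψ (f x)‖ ≤ ‖ψ.toBCF‖ := ψ.toBCF.norm_coe_le_norm (f x)
          rw [ZeroAtInftyContinuousMap.norm_toBCF_eq_norm] at h1
          exact mul_le_mul_of_nonneg_right h1 (norm_nonneg _)

/-- The product of a compactly supported real function with an element of `C₀(X)`. -/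
def cutoff (ρ : C(X, ℝ)) (hρ : HasCompactSupport ρ) (φ : C₀(X, ℂ)) : C₀(X, ℂ) where
  toFun x := (ρ x : ℂ) * φ x
  continuous_toFun := (Complex.continuous_ofReal.comp ρ.continuous).mul φ.continuous
  zero_at_infty' := by
    have h : HasCompactSupport fun x => (ρ x : ℂ) :=
      hρ.comp_left (g := fun r : ℝ => (r : ℂ)) Complex.ofReal_zero
    exact (h.mul_right (f' := ⇑φ)).is_zero_at_infty

theorem cutoff_apply (ρ : C(X, ℝ)) (hρ : HasCompactSupport ρ) (φ : C₀(X, ℂ)) (x : X) :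
    cutoff ρ hρ φ x = (ρ x : ℂ) * φ x := rfl

theorem tsupport_cutoff_subset_left (ρ : C(X, ℝ)) (hρ : HasCompactSupport ρ) (φ : C₀(X, ℂ)) :
    tsupport (cutoff ρ hρ φ) ⊆ tsupport ρ := by
  refine closure_mono fun x hx hx' => hx ?_
  simp [cutoff_apply, hx']

theorem tsupport_cutoff_subset_right (ρ : C(X, ℝ)) (hρ : HasCompactSupport ρ) (φ : C₀(X, ℂ)) :
    tsupport (cutoff ρ hρ φ) ⊆ tsupport φ := by
  refine closure_mono fun x hx hx' => hx ?_
  simp [cutoff_apply, hx']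

theorem exists_norm_cutoff_sub_le [T2Space X] [LocallyCompactSpace X] (φ : C₀(X, ℂ))
    {ε : ℝ} (hε : 0 < ε) :
    ∃ (ρ : C(X, ℝ)) (hρ : HasCompactSupport ρ), ‖cutoff ρ hρ φ - φ‖ ≤ ε := by
  obtain ⟨K, hK, hKφ⟩ := mem_cocompact.1 (φ.zero_at_infty' (Metric.ball_mem_nhds 0 hε))
  obtain ⟨ρ, hρ1, -, hρ, hρI⟩ :=
    exists_continuous_one_zero_of_isCompact hK isClosed_empty (Set.disjoint_empty K)
  refine ⟨ρ, hρ, ?_⟩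
  rw [← ZeroAtInftyContinuousMap.norm_toBCF_eq_norm, BoundedContinuousFunction.norm_le hε.le]
  intro x
  change ‖(ρ x : ℂ) * φ x - φ x‖ ≤ ε
  by_cases hx : x ∈ K
  · simp [hρ1 hx, hε.le]
  · have h1 : ‖φ x‖ < ε := by simpa using hKφ hx
    have h2 : (ρ x : ℂ) * φ x - φ x = ((ρ x - 1 : ℝ) : ℂ) * φ x := by push_cast; ring
    have h3 : |ρ x - 1| ≤ 1 := abs_le.2 ⟨by linarith [(hρI x).1], by linarith [(hρI x).2]⟩
    rw [h2, norm_mul, Complex.norm_real, Real.norm_eq_abs]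
    exact (mul_le_of_le_one_left (norm_nonneg _) h3).trans h1.le

/-- A property of functions that is stable under sums and holds for functions supported near
any point of the compact support of `φ` holds for `φ`. -/
theorem of_locally_of_hasCompactSupport [T2Space X] [LocallyCompactSpace X]
    {P : C₀(X, ℂ) → Prop} (h0 : P 0) (hadd : ∀ φ ψ, P φ → P ψ → P (φ + ψ))
    {φ : C₀(X, ℂ)} (hφ : HasCompactSupport φ)
    (hloc : ∀ x ∈ tsupport φ, ∃ U : Set X, IsOpen U ∧ x ∈ U ∧
      ∀ φ' : C₀(X, ℂ), tsupport φ' ⊆ U → P φ') : P φ := by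
  choose! U hUo hxU hU using hloc
  obtain ⟨t, ht, hcov⟩ := hφ.isCompact.elim_nhds_subcover U
    fun x hx => (hUo x hx).mem_nhds (hxU x hx)
  let e := t.equivFin
  obtain ⟨ρ, hρU, hρ1, -, hρ⟩ := exists_continuous_sum_one_of_isOpen_isCompact
    (s := fun i => U (e.symm i)) (fun i => hUo _ (ht _ (e.symm i).2)) hφ.isCompact
    (hcov.trans (Set.iUnion₂_subset fun x hx =>
      Set.subset_iUnion_of_subset (e ⟨x, hx⟩) (by simp)))
  have hsum : φ = ∑ i, cutoff (ρ i) (hρ i) φ := by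
    ext x
    have hcoe : (∑ i, cutoff (ρ i) (hρ i) φ) x = ∑ i, (ρ i x : ℂ) * φ x :=
      map_sum (⟨⟨fun g : C₀(X, ℂ) => g x, rfl⟩, fun _ _ => rfl⟩ : C₀(X, ℂ) →+ ℂ) _ _
    rw [hcoe, ← Finset.sum_mul]
    by_cases hx : x ∈ tsupport φ
    · have h1 : ∑ i, ρ i x = 1 := by simpa using hρ1 hx
      rw [← Complex.ofReal_sum, h1, Complex.ofReal_one, one_mul]
    · rw [image_eq_zero_of_notMem_tsupport hx, mul_zero]
  rw [hsum]
  exact Finset.sum_induction _ P hadd h0 fun i _ =>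
    hU _ (ht _ (e.symm i).2) _ ((tsupport_cutoff_subset_left _ _ _).trans (hρU i))

theorem IsStarRep.map_zero {π : C₀(X, ℂ) → H₁ →L[ℂ] H₁} (hπ : IsStarRep π) : π 0 = 0 := by
  simpa using hπ.map_smul 0 0

theorem IsStarRep.continuous {π : C₀(X, ℂ) → H₁ →L[ℂ] H₁} (hπ : IsStarRep π) :
    Continuous π := by
  let F : C₀(X, ℂ) →⋆ₙₐ[ℂ] (H₁ →L[ℂ] H₁) :=
    { toFun := π
      map_smul' := hπ.map_smul
      map_zero' := hπ.map_zero
      map_add' := hπ.map_add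
      map_mul' := hπ.map_mul
      map_star' := fun φ => (hπ.map_star φ).symm }
  exact AddMonoidHomClass.continuous_of_bound F 1 fun φ =>
    (NonUnitalStarAlgHom.norm_apply_le F φ).trans_eq (one_mul _).symm

/-- Compactly supported functions whose supports have product disjoint from the support of `T`
compress `T` to zero. -/
theorem comp_comp_eq_zero_of_notMem_opSupport [T2Space X] [LocallyCompactSpace X]
    [T2Space Y] [LocallyCompactSpace Y]
    {πX : C₀(X, ℂ) → H₁ →L[ℂ] H₁} (hπX : IsStarRep πX)
    {πY : C₀(Y, ℂ) → H₂ →L[ℂ] H₂} (hπY : IsStarRep πY) {T : H₁ →L[ℂ] H₂}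
    {φ : C₀(X, ℂ)} (hφ : HasCompactSupport φ) {ψ : C₀(Y, ℂ)} (hψ : HasCompactSupport ψ)
    (h : ∀ x ∈ tsupport φ, ∀ y ∈ tsupport ψ, (y, x) ∉ opSupport πX πY T) :
    (πY ψ).comp (T.comp (πX φ)) = 0 := by
  refine of_locally_of_hasCompactSupport (P := fun φ => (πY ψ).comp (T.comp (πX φ)) = 0)
    (by simp [hπX.map_zero]) (fun φ₁ φ₂ h₁ h₂ => ?_) hφ fun x hx => ?_
  · rw [hπX.map_add, ContinuousLinearMap.comp_add, ContinuousLinearMap.comp_add, h₁, h₂,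
      add_zero]
  refine of_locally_of_hasCompactSupport (P := fun ψ => ∃ U : Set X, IsOpen U ∧ x ∈ U ∧
    ∀ φ' : C₀(X, ℂ), tsupport φ' ⊆ U → (πY ψ).comp (T.comp (πX φ')) = 0)
    ⟨Set.univ, isOpen_univ, trivial, by simp [hπY.map_zero]⟩ ?_ hψ fun y hy => ?_
  · rintro ψ₁ ψ₂ ⟨U₁, ho₁, hx₁, h₁⟩ ⟨U₂, ho₂, hx₂, h₂⟩
    refine ⟨U₁ ∩ U₂, ho₁.inter ho₂, ⟨hx₁, hx₂⟩, fun φ' hφ' => ?_⟩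
    rw [hπY.map_add, ContinuousLinearMap.add_comp, h₁ φ' (hφ'.trans Set.inter_subset_left),
      h₂ φ' (hφ'.trans Set.inter_subset_right), add_zero]
  · have hxy := h x hx y hy
    simp only [opSupport, Set.mem_ofPred_eq] at hxy
    push Not at hxy
    obtain ⟨U, W, hU, hW, hxU, hyW, hUW⟩ := hxy
    exact ⟨W, hW, hyW, fun ψ' hψ' => ⟨U, hU, hxU, fun φ' hφ' => hUW φ' ψ' hφ' hψ'⟩⟩

theorem tsupport_mulCompC0_subset_left (f : C(X, Y)) (χ : C₀(Y, ℂ)) (φ : C₀(X, ℂ)) :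
    tsupport (mulCompC0 f χ φ) ⊆ f ⁻¹' tsupport χ := by
  refine closure_minimal (fun x hx => subset_tsupport _ fun hx' => hx ?_)
    ((isClosed_tsupport _).preimage f.continuous)
  change χ (f x) * φ x = 0
  rw [hx', zero_mul]

/-- The support over `X` of an operator maps into its support over `Y`. -/
theorem map_mem_opSupport [T2Space Y] [LocallyCompactSpace Y]
    {πX : C₀(X, ℂ) → H₁ →L[ℂ] H₁} {πY : C₀(Y, ℂ) → H₂ →L[ℂ] H₂} {f : C(X, Y)}
    {πXY : C₀(Y, ℂ) → H₁ →L[ℂ] H₁}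
    (hπXYf : ∀ (χ : C₀(Y, ℂ)) (φ : C₀(X, ℂ)) (ξ : H₁),
      πXY χ (πX φ ξ) = πX (mulCompC0 f χ φ) ξ)
    {T : H₁ →L[ℂ] H₂} {x : X} {y : Y} (h : (y, x) ∈ opSupport πX πY T) :
    (y, f x) ∈ opSupport πXY πY T := by
  intro U W hU hW hxU hyW
  obtain ⟨O, hO, hxO, hOU, hOc⟩ := exists_open_between_and_isCompact_closure
    (isCompact_singleton (x := f x)) hU (by simpa using hxU)
  obtain ⟨ρ, hρ1, hρ, hρU, -⟩ := exists_continuousMap_one_of_isCompact_subset_isOpen hOc hU hOU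
  let χ : C₀(Y, ℂ) :=
    { toFun := fun z => (ρ z : ℂ)
      continuous_toFun := Complex.continuous_ofReal.comp ρ.continuous
      zero_at_infty' := (HasCompactSupport.comp_left hρ (g := fun r : ℝ => (r : ℂ))
        Complex.ofReal_zero).is_zero_at_infty }
  obtain ⟨φ, ψ, hφ, hψ, hne⟩ := h (f ⁻¹' O) W (hO.preimage f.continuous) hW
    (hxO rfl) hyW
  have hχρ : tsupport χ ⊆ tsupport ρ := by
    refine closure_mono fun z hz hz' => hz ?_
    change (ρ z : ℂ) = 0
    rw [hz', Complex.ofReal_zero]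
  refine ⟨χ, ψ, hχρ.trans hρU, hψ, fun h0 => hne ?_⟩
  · have hmul : mulCompC0 f χ φ = φ := by
      ext z
      change (ρ (f z) : ℂ) * φ z = φ z
      by_cases hz : z ∈ tsupport φ
      · simp [hρ1 (subset_closure (hφ hz))]
      · simp [image_eq_zero_of_notMem_tsupport hz]
    ext ξ
    have := DFunLike.congr_fun h0 (πX φ ξ)
    simpa [hπXYf, hmul] using this

/-- The support over `Y` of an operator lies in the closure of the image of its support
over `X`. -/
theorem opSupport_subset_closure_image [T2Space X] [LocallyCompactSpace X]
    [T2Space Y] [LocallyCompactSpace Y]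
    {πX : C₀(X, ℂ) → H₁ →L[ℂ] H₁} (hπX : IsStarRep πX)
    {πY : C₀(Y, ℂ) → H₂ →L[ℂ] H₂} (hπY : IsStarRep πY) {f : C(X, Y)}
    {πXY : C₀(Y, ℂ) → H₁ →L[ℂ] H₁}
    (hπXYf : ∀ (χ : C₀(Y, ℂ)) (φ : C₀(X, ℂ)) (ξ : H₁),
      πXY χ (πX φ ξ) = πX (mulCompC0 f χ φ) ξ)
    (T : H₁ →L[ℂ] H₂) :
    opSupport πXY πY T ⊆ closure (Prod.map id f '' opSupport πX πY T) := by
  rintro ⟨y, y'⟩ h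
  by_contra hcl
  obtain ⟨W, W', hW, hyW, hW', hyW', hdisj⟩ :=
    mem_nhds_prod_iff'.1 (isClosed_closure.isOpen_compl.mem_nhds hcl)
  obtain ⟨O, hO, hyO, hOW, hOc⟩ := exists_open_between_and_isCompact_closure
    (isCompact_singleton (x := y)) hW (by simpa using hyW)
  obtain ⟨χ, ψ, hχ, hψ, hne⟩ := h W' O hW' hO hyW' (hyO rfl)
  have hψc : HasCompactSupport ψ :=
    hOc.of_isClosed_subset (isClosed_tsupport _) (hψ.trans subset_closure)
  have hvanish : ∀ φ : C₀(X, ℂ), HasCompactSupport φ → tsupport φ ⊆ f ⁻¹' W' →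
      (πY ψ).comp (T.comp (πX φ)) = 0 := fun φ hφ hφW =>
    comp_comp_eq_zero_of_notMem_opSupport hπX hπY hφ hψc fun x hx z hz hzx =>
      hdisj (Set.mk_mem_prod (hOW (subset_closure (hψ hz))) (hφW hx))
        (subset_closure ⟨(z, x), hzx, rfl⟩)
  have hvanish' : ∀ φ : C₀(X, ℂ), tsupport φ ⊆ f ⁻¹' W' →
      (πY ψ).comp (T.comp (πX φ)) = 0 := by
    intro φ hφW
    have hclosed : IsClosed {g : C₀(X, ℂ) | (πY ψ).comp (T.comp (πX g)) = 0} :=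
      isClosed_eq (continuous_const.clm_comp (continuous_const.clm_comp hπX.continuous))
        continuous_const
    refine hclosed.closure_subset (Metric.mem_closure_iff.2 fun ε hε => ?_)
    obtain ⟨ρ, hρ, hle⟩ := exists_norm_cutoff_sub_le φ (half_pos hε)
    refine ⟨cutoff ρ hρ φ, hvanish _ (hρ.mono' ?_)
      ((tsupport_cutoff_subset_right _ _ _).trans hφW), ?_⟩
    · exact subset_closure.trans (tsupport_cutoff_subset_left _ _ _)
    · rw [dist_comm, dist_eq_norm]
      linarith
  refine hne (ContinuousLinearMap.ext_on hπX.nondeg ?_)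
  rintro _ ⟨⟨φ, ξ⟩, rfl⟩
  have := DFunLike.congr_fun (hvanish' (mulCompC0 f χ φ)
    ((tsupport_mulCompC0_subset_left f χ φ).trans (Set.preimage_mono hχ))) ξ
  simpa [hπXYf] using this

/-- An open neighbourhood of the diagonal in a compact Hausdorff square contains the closure of
a smaller one. -/
theorem exists_isOpen_diagonal_closure_subset {Z : Type*} [TopologicalSpace Z] [T2Space Z]
    [CompactSpace Z] {U : Set (Z × Z)} (hU : IsOpen U) (hd : ∀ z, (z, z) ∈ U) :
    ∃ U' : Set (Z × Z), IsOpen U' ∧ (∀ z, (z, z) ∈ U') ∧ closure U' ⊆ U := by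
  obtain ⟨U', hU', hsub, hcl⟩ := normal_exists_closure_subset isClosed_diagonal hU
    (by rintro ⟨a, b⟩ (rfl : a = b); exact hd a)
  exact ⟨U', hU', fun z => hsub rfl, hcl⟩

/-- a family of isometries `(V_t : H₁ → H₂)` is a continuous cover of a
continuous map `f : X → Y` if and only if it is a continuous cover of the identity map of
`Y`, when `H₁` is regarded as a `Y`-module `(H₁)_Y` via `f* : C₀(Y) → C_b(X)`.  Here
`πXY` is the `(H₁)_Y`-structure, characterized by `πXY ψ (πX φ ξ) = πX ((ψ∘f)·φ) ξ`. -/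
theorem statement4
    {X Y : Type*} [TopologicalSpace X] [T2Space X] [LocallyCompactSpace X]
    [SecondCountableTopology X] [TopologicalSpace Y] [T2Space Y] [LocallyCompactSpace Y]
    [SecondCountableTopology Y]
    {H₁ H₂ : Type*}
    [NormedAddCommGroup H₁] [InnerProductSpace ℂ H₁] [CompleteSpace H₁]
    [SecondCountableTopology H₁]
    [NormedAddCommGroup H₂] [InnerProductSpace ℂ H₂] [CompleteSpace H₂]
    [SecondCountableTopology H₂]
    (πX : C₀(X, ℂ) → H₁ →L[ℂ] H₁) (hπX : IsStarRep πX)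
    (πY : C₀(Y, ℂ) → H₂ →L[ℂ] H₂) (hπY : IsStarRep πY)
    (f : C(X, Y))
    (πXY : C₀(Y, ℂ) → H₁ →L[ℂ] H₁) (hπXY : IsStarRep πXY)
    (hπXYf : ∀ (ψ : C₀(Y, ℂ)) (φ : C₀(X, ℂ)) (ξ : H₁),
      πXY ψ (πX φ ξ) = πX (mulCompC0 f ψ φ) ξ)
    (V : ℝ → H₁ →L[ℂ] H₂) :
    IsContCover πX πY (⇑f) V ↔ IsContCover πXY πY (id : Y → Y) V := by
  refine and_congr_right fun _ => and_congr_right fun _ => ⟨fun h U hU hd => ?_,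
    fun h U hU hd => ?_⟩
  · obtain ⟨U', hU', hd', hcl⟩ := exists_isOpen_diagonal_closure_subset hU hd
    obtain ⟨tU, h1, ht⟩ := h U' hU' hd'
    refine ⟨tU, h1, fun t htt p hp => hcl ?_⟩
    have hc : Continuous (Prod.map ((↑) : Y → OnePoint Y) ((↑) : Y → OnePoint Y)) :=
      OnePoint.continuous_coe.prodMap OnePoint.continuous_coe
    refine closure_minimal ?_ (isClosed_closure.preimage hc)
      (opSupport_subset_closure_image hπX hπY hπXYf (V t) hp)
    rintro _ ⟨q, hq, rfl⟩
    exact subset_closure (ht t htt hq)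
  · obtain ⟨tU, h1, ht⟩ := h U hU hd
    exact ⟨tU, h1, fun t htt p hp => ht t htt (map_mem_opSupport hπXYf hp)⟩

end Stmt
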